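/- The set of strictly convex bodies in ℝ^n is a dense G_δ subset of the space of all convex bodies with the Hausdorff metric; in particular, it is a Baire space. -/

import Mathlib

open Metric Set Filter Topology

/-- The distance to a nonempty convex set is a convex function. -/
theorem Convex.convexOn_infDist {E : Type*} [SeminormedAddCommGroup E] [NormedSpace ℝ E]
    {s : Set E} (hs : Convex ℝ s) (hne : s.Nonempty) :
    ConvexOn ℝ univ fun x => infDist x s := by
  refine ⟨convex_univ, fun x _ y _ a b ha hb hab => le_of_forall_pos_le_add fun ε hε => ?_⟩
  obtain ⟨p, hp, hxp⟩ := (infDist_lt_iff hne).1 (lt_add_of_pos_right (infDist x s) hε)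
  obtain ⟨q, hq, hyq⟩ := (infDist_lt_iff hne).1 (lt_add_of_pos_right (infDist y s) hε)
  calc infDist (a • x + b • y) s ≤ dist (a • x + b • y) (a • p + b • q) :=
        infDist_le_dist_of_mem (hs hp hq ha hb hab)
    _ ≤ dist (a • x) (a • p) + dist (b • y) (b • q) := dist_add_add_le _ _ _ _
    _ = a * dist x p + b * dist y q := by
        rw [dist_smul₀, dist_smul₀, Real.norm_of_nonneg ha, Real.norm_of_nonneg hb]
    _ ≤ a * (infDist x s + ε) + b * (infDist y s + ε) := by gcongr
    _ = a • infDist x s + b • infDist y s + ε := by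
        simp only [smul_eq_mul]; linear_combination ε * hab

/-- A closed convex set is strictly convex as soon as midpoints of distinct points are interior. -/
theorem Convex.strictConvex_of_midpoint_mem_interior {E : Type*} [SeminormedAddCommGroup E]
    [NormedSpace ℝ E] {s : Set E} (hs : Convex ℝ s)
    (h : ∀ x ∈ s, ∀ y ∈ s, x ≠ y → midpoint ℝ x y ∈ interior s) : StrictConvex ℝ s := by
  intro x hx y hy hxy a b ha hb hab
  have hm := h x hx y hy hxy
  have hb' : b = 1 - a := by linarith
  rcases le_total a b with hle | hle
  · have := hs.combo_interior_self_mem_interior hm hy (a := 2 * a) (b := b - a)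
      (by linarith) (by linarith) (by linarith)
    convert! this using 1
    rw [midpoint_eq_smul_add, invOf_eq_inv]
    module
  · have := hs.combo_interior_self_mem_interior hm hx (a := 2 * b) (b := a - b)
      (by linarith) (by linarith) (by linarith)
    convert! this using 1
    rw [midpoint_eq_smul_add, invOf_eq_inv]
    module

/-- The closed sublevel sets of a continuous strictly convex function are strictly convex. -/
theorem StrictConvexOn.strictConvex_setOf_le {E : Type*} [AddCommGroup E] [Module ℝ E]
    [TopologicalSpace E] {f : E → ℝ} (hf : StrictConvexOn ℝ univ f) (hc : Continuous f) (c : ℝ) :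
    StrictConvex ℝ {x | f x ≤ c} := by
  intro x hx y hy hxy a b ha hb hab
  have hlt : f (a • x + b • y) < c :=
    calc f (a • x + b • y) < a • f x + b • f y := hf.2 (mem_univ x) (mem_univ y) hxy ha hb hab
      _ ≤ a • c + b • c := by
        simp only [smul_eq_mul]
        exact add_le_add (mul_le_mul_of_nonneg_left hx ha.le) (mul_le_mul_of_nonneg_left hy hb.le)
      _ = c := by rw [← add_smul, hab, one_smul]
  exact interior_maximal (fun z (hz : f z < c) => hz.le) (isOpen_lt hc continuous_const) hlt

section InnerProductSpace

variable {E : Type*} [NormedAddCommGroup E] [InnerProductSpace ℝ E]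

/-- A point outside a complete convex set can be moved by any prescribed distance `r` to a point
farther than `r` from the set. -/
theorem Convex.exists_dist_eq_forall_lt_dist {s : Set E} (hs : Convex ℝ s) (hc : IsComplete s)
    (hne : s.Nonempty) {p : E} (hp : p ∉ s) {r : ℝ} (hr : 0 ≤ r) :
    ∃ q, dist q p = r ∧ ∀ x ∈ s, r < dist q x := by
  obtain ⟨v, hv, hmin⟩ := exists_norm_eq_iInf_of_complete_convex hne hc hs p
  rw [norm_eq_iInf_iff_real_inner_le_zero hs hv] at hmin
  set u := p - v with hu
  have hu0 : 0 < ‖u‖ := norm_pos_iff.2 (sub_ne_zero.2 fun h => hp (h ▸ hv))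
  refine ⟨p + (r / ‖u‖) • u, ?_, fun x hx => ?_⟩
  · rw [dist_eq_norm, add_sub_cancel_left, norm_smul, norm_div, norm_norm,
      Real.norm_of_nonneg hr, div_mul_cancel₀ _ hu0.ne']
  · have hinner : inner ℝ u (p + (r / ‖u‖) • u - x) =
        ‖u‖ ^ 2 + r * ‖u‖ - inner ℝ u (x - v) := by
      have : p + (r / ‖u‖) • u - x = u + (r / ‖u‖) • u - (x - v) := by rw [hu]; abel
      rw [this, inner_sub_right, inner_add_right, inner_smul_right, real_inner_self_eq_norm_sq]
      field_simp
    have hle := real_inner_le_norm u (p + (r / ‖u‖) • u - x)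
    have hx' := hmin x hx
    rw [dist_eq_norm]
    nlinarith [pow_pos hu0 2]

/-- If a convex body contains a ball of radius `r + s`, then every convex body at Hausdorff
distance less than `r` contains the concentric ball of radius `s`. -/
theorem ConvexBody.ball_subset_of_dist_lt {K L : ConvexBody E} {m : E} {r s : ℝ}
    (hK : ball m (r + s) ⊆ (K : Set E)) (h : dist K L < r) : ball m s ⊆ (L : Set E) := by
  intro p hp
  by_contra hpL
  obtain ⟨q, hqp, hq⟩ := L.convex.exists_dist_eq_forall_lt_dist L.isCompact.isComplete L.nonempty
    hpL (dist_nonneg.trans h.le)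
  have hqK : q ∈ (K : Set E) := hK <| by
    rw [mem_ball] at hp ⊢
    linarith [dist_triangle q p m]
  obtain ⟨x, hx, hqx⟩ := exists_dist_lt_of_hausdorffDist_lt hqK h ConvexBody.hausdorffEDist_ne_top
  exact (hq x hx).not_gt hqx

/-- For a strictly convex body, midpoints of points at a definite distance from each other remain
interior for all nearby convex bodies. -/
theorem ConvexBody.eventually_midpoint_mem_interior {K : ConvexBody E}
    (hK : StrictConvex ℝ (K : Set E)) {ε : ℝ} (hε : 0 < ε) :
    ∀ᶠ L : ConvexBody E in 𝓝 K, ∀ x ∈ L, ∀ y ∈ L, ε ≤ dist x y → midpoint ℝ x y ∈ interior (L : Set E) := by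
  let S : Set (E × E) := (K : Set E) ×ˢ (K : Set E) ∩ {p | ε / 2 ≤ dist p.1 p.2}
  have hS : IsCompact S := (K.isCompact.prod K.isCompact).inter_right
    (isClosed_le continuous_const continuous_dist)
  have hcont : Continuous fun p : E × E => midpoint ℝ p.1 p.2 := by
    simp only [midpoint_eq_smul_add]
    fun_prop
  obtain ⟨δ, hδ, hsub⟩ := (hS.image hcont).exists_thickening_subset_open isOpen_interior <| by
    rintro _ ⟨⟨x, y⟩, ⟨⟨hx, hy⟩, hxy⟩, rfl⟩
    refine hK.openSegment_subset hx hy ?_ (midpoint_mem_openSegment x y)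
    intro (h : x = y)
    have hxy' : ε / 2 ≤ dist x y := hxy
    rw [h, dist_self] at hxy'
    linarith
  have hη : 0 < min (δ / 2) (ε / 4) := by positivity
  filter_upwards [ball_mem_nhds K hη] with L hL x hx y hy hxy
  have hLK : dist L K < min (δ / 2) (ε / 4) := hL
  obtain ⟨x', hx', hxx⟩ :=
    exists_dist_lt_of_hausdorffDist_lt hx hLK ConvexBody.hausdorffEDist_ne_top
  obtain ⟨y', hy', hyy⟩ :=
    exists_dist_lt_of_hausdorffDist_lt hy hLK ConvexBody.hausdorffEDist_ne_top
  have hx4 := hxx.trans_le (min_le_right _ _)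
  have hy4 := hyy.trans_le (min_le_right _ _)
  have hxy' : ε / 2 ≤ dist x' y' := by
    linarith [dist_triangle4 x x' y' y, dist_comm y y']
  have hball : ball (midpoint ℝ x' y') (δ / 2 + δ / 2) ⊆ (K : Set E) := by
    rw [add_halves]
    exact (ball_subset_thickening (mem_image_of_mem _ (show (x', y') ∈ S from
      ⟨⟨hx', hy'⟩, hxy'⟩)) δ).trans (hsub.trans interior_subset)
  have hL' := ConvexBody.ball_subset_of_dist_lt hball
    ((dist_comm K L).trans_lt (hLK.trans_le (min_le_left _ _)))
  refine interior_maximal hL' isOpen_ball ?_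
  rw [mem_ball]
  have := dist_midpoint_midpoint_le (V := E) x y x' y'
  have hx2 := hxx.trans_le (min_le_left _ _)
  have hy2 := hyy.trans_le (min_le_left _ _)
  linarith

/-- The strictly convex bodies form a `G_δ` set. -/
theorem ConvexBody.isGδ_strictConvex :
    IsGδ {K : ConvexBody E | StrictConvex ℝ (K : Set E)} := by
  have heq : {K : ConvexBody E | StrictConvex ℝ (K : Set E)} =
      ⋂ k : ℕ, interior {L : ConvexBody E | ∀ x ∈ L, ∀ y ∈ L,
        1 / ((k : ℝ) + 1) ≤ dist x y → midpoint ℝ x y ∈ interior (L : Set E)} := by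
    refine Subset.antisymm (fun K hK => mem_iInter.2 fun k => mem_interior_iff_mem_nhds.2 <|
      ConvexBody.eventually_midpoint_mem_interior hK Nat.one_div_pos_of_nat) fun K hK => ?_
    refine K.convex.strictConvex_of_midpoint_mem_interior fun x hx y hy hxy => ?_
    obtain ⟨k, hk⟩ := exists_nat_one_div_lt (dist_pos.2 hxy)
    exact interior_subset (mem_iInter.1 hK k) x hx y hy hk.le
  rw [heq]
  exact IsGδ.iInter_of_isOpen fun k => isOpen_interior

/-- The strictly convex bodies are dense among all convex bodies. -/
theorem ConvexBody.dense_strictConvex [ProperSpace E] :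
    Dense {K : ConvexBody E | StrictConvex ℝ (K : Set E)} := by
  refine Metric.dense_iff.2 fun K r hr => ?_
  obtain ⟨R, hR, hKR⟩ := K.isBounded.exists_pos_norm_le
  obtain ⟨δ, hδ, hδr⟩ : ∃ δ > 0, δ * R ^ 2 < r :=
    ⟨r / 2 / R ^ 2, by positivity, by rw [div_mul_cancel₀ _ (by positivity)]; linarith⟩
  let f : E → ℝ := fun x => infDist x (K : Set E) + δ * ‖x‖ ^ 2
  have hf : Continuous f := by
    have := continuous_infDist_pt (K : Set E)
    fun_prop
  have hconv : StrictConvexOn ℝ univ f := by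
    refine StrongConvexOn.strictConvexOn (m := 2 * δ) ?_ (by positivity)
    rw [strongConvexOn_iff_convex]
    convert! K.convex.convexOn_infDist K.nonempty using 2 with x
    simp only [f]
    ring
  have hsub : (K : Set E) ⊆ {x | f x ≤ δ * R ^ 2} := fun x hx => by
    have := hKR x hx
    change infDist x (K : Set E) + δ * ‖x‖ ^ 2 ≤ δ * R ^ 2
    rw [infDist_zero_of_mem hx, zero_add]
    gcongr
  have hbdd : {x | f x ≤ δ * R ^ 2} ⊆ closedBall 0 R := fun x hx => by
    rw [mem_closedBall_zero_iff]
    have h1 : δ * ‖x‖ ^ 2 ≤ δ * R ^ 2 := le_trans (le_add_of_nonneg_left infDist_nonneg) hx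
    exact le_of_sq_le_sq (le_of_mul_le_mul_left h1 hδ) hR.le
  have hstrict := hconv.strictConvex_setOf_le hf (δ * R ^ 2)
  let L : ConvexBody E := ⟨{x | f x ≤ δ * R ^ 2}, hstrict.convex,
    (isCompact_closedBall 0 R).of_isClosed_subset (isClosed_le hf continuous_const) hbdd,
    K.nonempty.mono hsub⟩
  refine ⟨L, lt_of_le_of_lt (hausdorffDist_le_of_infDist (by positivity) ?_ ?_) hδr, hstrict⟩
  · intro x hx
    exact le_trans (le_add_of_nonneg_right (by positivity)) hx
  · intro x hx
    exact (infDist_zero_of_mem (s := (L : Set E)) (hsub hx)).trans_le (by positivity)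

end InnerProductSpace

/-- The space of convex bodies in a Banach space is complete. -/
instance ConvexBody.instCompleteSpace {E : Type*} [NormedAddCommGroup E] [NormedSpace ℝ E]
    [CompleteSpace E] : CompleteSpace (ConvexBody E) := by
  let φ : ConvexBody E → TopologicalSpace.NonemptyCompacts E :=
    fun K => ⟨⟨K, K.isCompact⟩, K.nonempty⟩
  have hφ : Isometry φ := fun K L => ConvexBody.hausdorffEDist_coe K L
  refine Metric.complete_of_cauchySeq_tendsto fun u hu => ?_
  obtain ⟨C, hC⟩ := cauchySeq_tendsto_of_complete (hφ.uniformContinuous.comp_cauchySeq hu)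
  have hlim (x : E) : Tendsto (fun n => infDist x (u n : Set E)) atTop (𝓝 (infDist x C)) := by
    have hcont : Continuous fun s : TopologicalSpace.NonemptyCompacts E => infDist x s :=
      (Metric.lipschitz_infDist_set x).continuous
    have hcomp := (hcont.tendsto C).comp hC
    refine hcomp.congr fun n => ?_
    rfl
  have hmem {x : E} : x ∈ (C : Set E) ↔ infDist x C = 0 :=
    C.isCompact.isClosed.mem_iff_infDist_zero C.nonempty
  have hconv : Convex ℝ (C : Set E) := by
    intro x hx y hy a b ha hb hab
    refine hmem.2 (le_antisymm ?_ infDist_nonneg)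
    have h := le_of_tendsto_of_tendsto' (hlim (a • x + b • y))
      (((hlim x).const_smul a).add ((hlim y).const_smul b)) fun n =>
        ((u n).convex.convexOn_infDist (u n).nonempty).2 (mem_univ x) (mem_univ y) ha hb hab
    rwa [hmem.1 hx, hmem.1 hy, smul_zero, smul_zero, add_zero] at h
  exact ⟨⟨C, hconv, C.isCompact, C.nonempty⟩, hφ.isEmbedding.tendsto_nhds_iff.2 hC⟩

/-- The set of strictly convex bodies in `ℝⁿ` is a dense `G_δ` subset of the space of all convex
bodies with the Hausdorff metric; in particular, it is a Baire space (as a subspace). -/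
theorem stmt7 (n : ℕ) :
    IsGδ {K : ConvexBody (EuclideanSpace ℝ (Fin n)) |
        StrictConvex ℝ (K : Set (EuclideanSpace ℝ (Fin n)))} ∧
    Dense {K : ConvexBody (EuclideanSpace ℝ (Fin n)) |
        StrictConvex ℝ (K : Set (EuclideanSpace ℝ (Fin n)))} ∧
    BaireSpace {K : ConvexBody (EuclideanSpace ℝ (Fin n)) //
        StrictConvex ℝ (K : Set (EuclideanSpace ℝ (Fin n)))} :=
  ⟨ConvexBody.isGδ_strictConvex, ConvexBody.dense_strictConvex,
    ConvexBody.isGδ_strictConvex.baireSpace_of_dense ConvexBody.dense_strictConvex⟩
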